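/- Any tableau t ∈ ⋃_{k=0}^{s−1} B(kϖ₂) has at most two filling locations. If it has two, they are consecutive integers, and the tableau F_{2,s}(t) obtained is the same for either choice of filling location. -/

import Mathlib

namespace KR

/-- A letter of the type `Dₙ` alphabet: `pos i` is the unbarred letter `i`
(1-based, valid when `1 ≤ i ≤ n`), `neg i` is the barred letter `ī`. -/
inductive Letter : Type
  | pos : ℕ → Letter
  | neg : ℕ → Letter
deriving DecidableEq

namespace Letter

/-- The bar involution. -/
def bar : Letter → Letter
  | pos i => neg i
  | neg i => pos i

/-- Validity of a letter for the alphabet of type `Dₙ`. -/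
def valid (n : ℕ) : Letter → Prop
  | pos i => 1 ≤ i ∧ i ≤ n
  | neg i => 1 ≤ i ∧ i ≤ n

/-- The partial order `1 < 2 < ⋯ < n-1 < n, n̄ < ⋯ < 2̄ < 1̄`
with `n` and `n̄` incomparable. -/
def le (n : ℕ) : Letter → Letter → Prop
  | pos i, pos j => i ≤ j
  | neg i, neg j => j ≤ i
  | pos i, neg j => ¬ (i = n ∧ j = n)
  | neg _, pos _ => False

end Letter

/-- A column `(a over b)` of a two-row tableau: `c.1` is the top letter,
`c.2` the bottom letter.  A tableau of shape `(k,k)` is a list of `k` columns. -/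
abbrev Col := Letter × Letter

def colValid (n : ℕ) (c : Col) : Prop := c.1.valid n ∧ c.2.valid n

/-- Criterion 1, condition (1): both rows weakly increasing. -/
def cond1 (n : ℕ) (T : List Col) : Prop :=
  List.Chain' (fun c d : Col => Letter.le n c.1 d.1 ∧ Letter.le n c.2 d.2) T

/-- Criterion 1, condition (2): in every column `(a over b)`, `b ≰ a`. -/
def cond2 (n : ℕ) (T : List Col) : Prop := ∀ c ∈ T, ¬ Letter.le n c.2 c.1

/-- Criterion 1, condition (3): no adjacent columns `(a|x)(a|ā)` or `(a|ā)(y|ā)`. -/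
def cond3 (T : List Col) : Prop :=
  List.Chain' (fun c d : Col =>
    ¬ (c.1 = d.1 ∧ d.2 = d.1.bar) ∧ ¬ (c.2 = c.1.bar ∧ d.2 = c.2)) T

/-- Criterion 1, condition (4): no (possibly non-adjacent) pair of columns
`(n-1|n) … (n|‾(n-1))` in that order, nor `(n-1|n̄) … (n̄|‾(n-1))`. -/
def cond4 (n : ℕ) (T : List Col) : Prop :=
  (¬ ∃ i j : ℕ, i < j ∧ T[i]? = some (Letter.pos (n-1), Letter.pos n) ∧
      T[j]? = some (Letter.pos n, Letter.neg (n-1))) ∧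
  (¬ ∃ i j : ℕ, i < j ∧ T[i]? = some (Letter.pos (n-1), Letter.neg n) ∧
      T[j]? = some (Letter.neg n, Letter.neg (n-1)))

/-- Criterion 1, condition (5): no column `(1 over 1̄)`. -/
def cond5 (T : List Col) : Prop := (Letter.pos 1, Letter.neg 1) ∉ T

/-- `B(kϖ₂)`: tableaux of shape `(k,k)` satisfying Criterion 1. -/
def BB (n k : ℕ) : Set (List Col) :=
  {T | T.length = k ∧ (∀ c ∈ T, colValid n c) ∧ cond1 n T ∧ cond2 n T ∧
       cond3 T ∧ cond4 n T ∧ cond5 T}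

/-- `𝒯(s)`: tableaux of shape `(s,s)` satisfying conditions (1), (2), (4). -/
def TT (n s : ℕ) : Set (List Col) :=
  {T | T.length = s ∧ (∀ c ∈ T, colValid n c) ∧ cond1 n T ∧ cond2 n T ∧ cond4 n T}

/-- A letter `a ∈ {1, …, n, n̄}`. -/
def aLetter (n : ℕ) : Letter → Prop
  | .pos i => 1 ≤ i ∧ i ≤ n
  | .neg i => i = n

/-- The column `(1 over 1̄)`. -/
def oneBarOne : Col := (Letter.pos 1, Letter.neg 1)

/-- `T` contains a maximal nonempty block of `m` consecutive columns `(a over ā)`,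
with prefix `L` and suffix `R`. -/
def maxBlock (T : List Col) (a : Letter) (m : ℕ) (L R : List Col) : Prop :=
  0 < m ∧ T = L ++ List.replicate m (a, a.bar) ++ R ∧
  (∀ c, L.getLast? = some c → c ≠ (a, a.bar)) ∧
  (∀ c, R.head? = some c → c ≠ (a, a.bar))

/-- The drop map `D_{2,s}` as a relation: `DropRel n s T T'` holds when `T'` is the
result of applying `D_{2,s}` to `T`. -/
def DropRel (n s : ℕ) (T T' : List Col) : Prop :=
  (T = List.replicate s oneBarOne ∧ T' = []) ∨
  (T ∈ BB n s ∧ T' = T) ∨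
  (T ≠ List.replicate s oneBarOne ∧ T ∉ BB n s ∧
    ∃ a m L R, aLetter n a ∧ maxBlock T a m L R ∧ T' = L ++ R)

/-- Criterion 2 at the (0-based) adjacent pair `(t[i], t[i+1])`:
`bᵢ ≤ āᵢ ≤ b_{i+1}` or `aᵢ ≤ ‾b_{i+1} ≤ a_{i+1}` (paper position `i+1`). -/
def crit2At (n : ℕ) (t : List Col) (i : ℕ) : Prop :=
  ∃ c d : Col, t[i]? = some c ∧ t[i+1]? = some d ∧
    ((Letter.le n c.2 c.1.bar ∧ Letter.le n c.1.bar d.2) ∨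
     (Letter.le n c.1 d.2.bar ∧ Letter.le n d.2.bar d.1))

/-- `i` is a filling location of `t` (paper indexing: `1 ≤ i ≤ k-1` interior,
`i = k` appending, `i = 0` prepending). -/
def isFillingLoc (n s : ℕ) (t : List Col) (i : ℕ) : Prop :=
  (1 ≤ i ∧ i + 1 ≤ t.length ∧ crit2At n t (i-1)) ∨
  (i = t.length ∧ 0 < t.length ∧ (∀ j, ¬ crit2At n t j) ∧
    ∃ c : Col, t.getLast? = some c ∧
      t ++ List.replicate (s - t.length) (c.1, c.1.bar) ∈ TT n s) ∨
  (i = 0 ∧ 0 < t.length ∧ (∀ j, ¬ crit2At n t j) ∧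
    ∃ c : Col, t.head? = some c ∧
      List.replicate (s - t.length) (c.2.bar, c.2) ++ t ∈ TT n s)

/-- `T` is a result of filling `t` at location `i` (inserting `s - k` columns). -/
def fillAtRel (n s : ℕ) (t : List Col) (i : ℕ) (T : List Col) : Prop :=
  (1 ≤ i ∧ i + 1 ≤ t.length ∧
    ∃ c d : Col, t[i-1]? = some c ∧ t[i]? = some d ∧
      ((Letter.le n c.2 c.1.bar ∧ Letter.le n c.1.bar d.2 ∧
         T = t.take i ++ List.replicate (s - t.length) (c.1, c.1.bar) ++ t.drop i) ∨
       (Letter.le n c.1 d.2.bar ∧ Letter.le n d.2.bar d.1 ∧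
         T = t.take i ++ List.replicate (s - t.length) (d.2.bar, d.2) ++ t.drop i))) ∨
  (i = t.length ∧ 0 < t.length ∧ (∀ j, ¬ crit2At n t j) ∧
    ∃ c : Col, t.getLast? = some c ∧
      T = t ++ List.replicate (s - t.length) (c.1, c.1.bar)) ∨
  (i = 0 ∧ 0 < t.length ∧ (∀ j, ¬ crit2At n t j) ∧
    ∃ c : Col, t.head? = some c ∧
      T = List.replicate (s - t.length) (c.2.bar, c.2) ++ t)

/-- The fill map `F_{2,s}` as a relation. -/
def FillRel (n s : ℕ) (t T : List Col) : Prop :=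
  (t.length = s ∧ T = t) ∨
  (t = [] ∧ T = List.replicate s oneBarOne) ∨
  (t ≠ [] ∧ t.length < s ∧ ∃ i, isFillingLoc n s t i ∧ fillAtRel n s t i T)

/-- `T` contains an `a`-configuration of size `m` (one of the three types of
Proposition `ablock`). -/
def hasAConfig (T : List Col) (a : Letter) (m : ℕ) : Prop :=
  (∃ L R : List Col, ∃ b c d : Letter, b ≠ a.bar ∧ (c ≠ a ∨ d ≠ a.bar) ∧
     T = L ++ [(a, b)] ++ List.replicate m (a, a.bar) ++ [(c, d)] ++ R) ∨
  (∃ L R : List Col, ∃ b c d : Letter, d ≠ a ∧ (b ≠ a ∨ c ≠ a.bar) ∧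
     T = L ++ [(b, c)] ++ List.replicate m (a, a.bar) ++ [(d, a.bar)] ++ R) ∨
  (∃ L R : List Col, ∃ b c d e : Letter, b ≠ a ∧ e ≠ a.bar ∧
     T = L ++ [(b, c)] ++ List.replicate (m+1) (a, a.bar) ++ [(d, e)] ++ R)

/-! ### Helper lemmas -/

theorem le_bar {n : ℕ} {x y : Letter} (h : Letter.le n x y) :
    Letter.le n y.bar x.bar := by
  cases x <;> cases y <;> simp_all [Letter.le, Letter.bar] <;> tauto

theorem bar_bar (x : Letter) : x.bar.bar = x := by cases x <;> rfl

theorem bar_valid {n : ℕ} {x : Letter} (h : x.valid n) : x.bar.valid n := by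
  cases x <;> exact h

theorem le_antisymm' {n : ℕ} {x y : Letter} (h : Letter.le n x y) (h' : Letter.le n y x) :
    x = y := by
  cases x <;> cases y <;> simp_all [Letter.le] <;> omega

theorem le_trans' {n : ℕ} {x y z : Letter} (hx : x.valid n) (hy : y.valid n) (hz : z.valid n)
    (h : Letter.le n x y) (h' : Letter.le n y z) : Letter.le n x z := by
  cases x <;> cases y <;> cases z <;> simp_all [Letter.le, Letter.valid] <;> omega

/-- Data extracted from membership in `BB` for adjacent columns. -/
theorem adj {n k : ℕ} {t : List Col} (ht : t ∈ BB n k) {i : ℕ} {c d : Col}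
    (hc : t[i]? = some c) (hd : t[i+1]? = some d) :
    Letter.le n c.1 d.1 ∧ Letter.le n c.2 d.2 ∧ ¬ (c.1 = d.1 ∧ d.2 = d.1.bar) := by
  obtain ⟨-, -, h1, -, h3, -, -⟩ := ht
  obtain ⟨hi, rfl⟩ := List.getElem?_eq_some_iff.1 hc
  obtain ⟨hj, rfl⟩ := List.getElem?_eq_some_iff.1 hd
  have a := (List.isChain_iff_getElem.1 h1) i hj
  have b := (List.isChain_iff_getElem.1 h3) i hj
  exact ⟨a.1, a.2, b.1⟩

theorem val {n k : ℕ} {t : List Col} (ht : t ∈ BB n k) {i : ℕ} {c : Col}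
    (hc : t[i]? = some c) : c.1.valid n ∧ c.2.valid n :=
  ht.2.1 c (List.mem_of_getElem? hc)

/-- `b̄ ≤ a` persists to the right. -/
theorem G_persist {n k : ℕ} {t : List Col} (ht : t ∈ BB n k) {i : ℕ} {c : Col}
    (hc : t[i]? = some c) (hG : Letter.le n c.2.bar c.1) (m : ℕ) {d : Col}
    (hd : t[i+m]? = some d) : Letter.le n d.2.bar d.1 := by
  induction m generalizing d with
  | zero =>
    have : c = d := by simpa [hc] using hd
    exact this ▸ hG
  | succ m ih =>
    obtain ⟨hj, -⟩ := List.getElem?_eq_some_iff.1 hd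
    have he : t[i+m]? = some (t[i+m]'(by omega)) := List.getElem?_eq_getElem _
    have g := ih he
    obtain ⟨a1, a2, -⟩ := adj ht he hd
    have v := val ht he
    have w := val ht hd
    exact le_trans' (bar_valid w.2) (bar_valid v.2) w.1 (le_bar a2)
      (le_trans' (bar_valid v.2) v.1 w.1 g a1)

/-- A column with `b̄ ≤ a` cannot be strictly to the left of one with `b ≤ ā`. -/
theorem G_not_L {n k : ℕ} {t : List Col} (ht : t ∈ BB n k) {i j : ℕ} {c d : Col}
    (hij : i < j) (hc : t[i]? = some c) (hG : Letter.le n c.2.bar c.1)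
    (hd : t[j]? = some d) (hL : Letter.le n d.2 d.1.bar) : False := by
  obtain ⟨m, rfl⟩ : ∃ m, j = i + m + 1 := ⟨j - i - 1, by omega⟩
  obtain ⟨hj, -⟩ := List.getElem?_eq_some_iff.1 hd
  have he : t[i+m]? = some (t[i+m]'(by omega)) := List.getElem?_eq_getElem _
  have g := G_persist ht hc hG m he
  have g' := G_persist ht hc hG (m+1) hd
  obtain ⟨a1, a2, a3⟩ := adj ht he hd
  have v := val ht he
  have w := val ht hd
  have hL' := le_bar hL
  rw [bar_bar] at hL'
  have e1 : d.1 = d.2.bar := le_antisymm' hL' g'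
  apply a3
  refine ⟨le_antisymm' a1 ?_, by rw [e1, bar_bar]⟩
  rw [e1]
  exact le_trans' (bar_valid w.2) (bar_valid v.2) v.1 (le_bar a2) g

theorem loc_spec {n s k : ℕ} (hk : k < s) {t : List Col} (ht : t ∈ BB n k) {i : ℕ}
    (h : isFillingLoc n s t i) :
    i ≤ t.length ∧ 0 < t.length ∧ (∀ c, t[i]? = some c → Letter.le n c.2.bar c.1) ∧
    (∀ j c, i = j + 1 → t[j]? = some c → Letter.le n c.2 c.1.bar) := by
  have hlen := ht.1
  obtain ⟨m, hm⟩ : ∃ m, s - t.length = m + 1 := ⟨s - t.length - 1, by omega⟩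
  rcases h with ⟨h1, h2, c, d, hc, hd, h⟩ | ⟨h1, h2, -, c, hc, hT⟩ | ⟨h1, h2, -, c, hc, hT⟩
  · obtain ⟨a1, a2, -⟩ := adj ht hc hd
    have v := val ht hc
    have w := val ht hd
    rw [show i - 1 + 1 = i by omega] at hd
    refine ⟨by omega, by omega, ?_, ?_⟩
    · intro c' hc'
      obtain rfl : d = c' := by simpa [hd] using hc'
      rcases h with ⟨p, q⟩ | ⟨p, q⟩
      · have q' := le_bar q
        rw [bar_bar] at q'
        exact le_trans' (bar_valid w.2) v.1 w.1 q' a1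
      · exact q
    · intro j c' hj hc'
      obtain rfl : j = i - 1 := by omega
      obtain rfl : c = c' := by simpa [hc] using hc'
      rcases h with ⟨p, q⟩ | ⟨p, q⟩
      · exact p
      · have p' := le_bar p
        rw [bar_bar] at p'
        exact le_trans' v.2 w.2 (bar_valid v.1) a2 p'
  · subst h1
    refine ⟨le_rfl, h2, ?_, ?_⟩
    · intro c hc
      simp at hc
    · intro j c' hj hc'
      rw [List.getLast?_eq_getElem?, show t.length - 1 = j by omega, hc'] at hc
      obtain rfl : c' = c := by simpa using hc
      rw [hm, List.replicate_succ] at hT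
      have h1 := hT.2.2.1
      unfold cond1 at h1
      have := (List.isChain_iff_getElem.1 h1) j (by simp; omega)
      obtain ⟨hjj, rfl⟩ := List.getElem?_eq_some_iff.1 hc'
      rw [List.getElem_append_left hjj] at this
      rw [List.getElem_append_right (by omega)] at this
      have hz : j + 1 - t.length = 0 := by omega
      simpa [hz] using this.2
  · subst h1
    refine ⟨by omega, h2, ?_, ?_⟩
    · intro c' hc'
      rw [List.head?_eq_getElem?, hc'] at hc
      obtain rfl : c' = c := by simpa using hc
      rw [hm, List.replicate_succ'] at hT
      have h1 := hT.2.2.1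
      unfold cond1 at h1
      have := (List.isChain_iff_getElem.1 h1) m (by simp; omega)
      obtain ⟨hjj, rfl⟩ := List.getElem?_eq_some_iff.1 hc'
      rw [List.getElem_append_left (by simp)] at this
      rw [List.getElem_append_right (by simp)] at this
      simpa using this.1
    · intro j c hj
      omega

/-- Filling just before a column `e = (a, ā)` inserts copies of `e`. -/
theorem fill_before {n s k : ℕ} {t : List Col} (ht : t ∈ BB n k) {i : ℕ} {T : List Col}
    (h : fillAtRel n s t i T) {e : Col} (he : t[i]? = some e) (hb : e.2 = e.1.bar) :
    T = t.take i ++ List.replicate (s - t.length) e ++ t.drop i := by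
  have hee : (e.1, e.1.bar) = e := by rw [← hb]
  have hee' : (e.2.bar, e.2) = e := by rw [hb, bar_bar, ← hb]
  rcases h with ⟨h1, h2, c, d, hc, hd, h⟩ | ⟨h1, -⟩ | ⟨h1, h2, -, c, hc, hT⟩
  · obtain rfl : d = e := by simpa [hd] using he
    have hd' : t[i-1+1]? = some d := by rw [show i - 1 + 1 = i by omega]; exact hd
    rcases h with ⟨p, q, rfl⟩ | ⟨p, q, rfl⟩
    · have q' := le_bar q
      rw [hb, bar_bar, bar_bar] at q'
      have : c.1 = d.1 := le_antisymm' (adj ht hc hd').1 q'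
      rw [this, hee]
    · rw [hee']
  · subst h1
    simp at he
  · subst h1
    rw [List.head?_eq_getElem?, he] at hc
    obtain rfl : e = c := by simpa using hc
    rw [hT, hee']
    simp

/-- Filling just after a column `e = (a, ā)` inserts copies of `e`. -/
theorem fill_after {n s k : ℕ} {t : List Col} (ht : t ∈ BB n k) {i : ℕ} {T : List Col}
    (h : fillAtRel n s t (i+1) T) {e : Col} (he : t[i]? = some e) (hb : e.2 = e.1.bar) :
    T = t.take (i+1) ++ List.replicate (s - t.length) e ++ t.drop (i+1) := by
  have hee : (e.1, e.1.bar) = e := by rw [← hb]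
  have hee' : (e.2.bar, e.2) = e := by rw [hb, bar_bar, ← hb]
  rcases h with ⟨h1, h2, c, d, hc, hd, h⟩ | ⟨h1, h2, -, c, hc, hT⟩ | ⟨h1, -⟩
  · rw [show i + 1 - 1 = i by omega] at hc
    obtain rfl : c = e := by simpa [hc] using he
    rcases h with ⟨p, q, rfl⟩ | ⟨p, q, rfl⟩
    · rw [hee]
    · have p' := le_bar p
      rw [bar_bar, ← hb] at p'
      have : c.2 = d.2 := le_antisymm' (adj ht hc hd).2.1 p'
      rw [← this, hee']
  · rw [List.getLast?_eq_getElem?, show t.length - 1 = i by omega, he] at hc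
    obtain rfl : e = c := by simpa using hc
    rw [hT, hee, h1]
    simp
  · omega

theorem loc_consec {n s k : ℕ} (hk : k < s) {t : List Col} (ht : t ∈ BB n k) {i j : ℕ}
    (hi : isFillingLoc n s t i) (hj : isFillingLoc n s t j) (hij : i < j) : i + 1 = j := by
  obtain ⟨-, -, g, -⟩ := loc_spec hk ht hi
  obtain ⟨hl, -, -, l⟩ := loc_spec hk ht hj
  by_contra hne
  have e1 : t[i]? = some (t[i]'(by omega)) := List.getElem?_eq_getElem _
  have e2 : t[j-1]? = some (t[j-1]'(by omega)) := List.getElem?_eq_getElem _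
  exact G_not_L ht (show i < j - 1 by omega) e1 (g _ e1) e2 (l _ _ (by omega) e2)

theorem fill_eq {n s k : ℕ} (hk : k < s) {t : List Col} (ht : t ∈ BB n k) {i j : ℕ}
    {T₁ T₂ : List Col} (hi : isFillingLoc n s t i) (hj : isFillingLoc n s t j)
    (h1 : fillAtRel n s t i T₁) (h2 : fillAtRel n s t j T₂) (hij : i < j) : T₁ = T₂ := by
  obtain rfl := loc_consec hk ht hi hj hij
  obtain ⟨-, -, g, -⟩ := loc_spec hk ht hi
  obtain ⟨hl, -, -, l⟩ := loc_spec hk ht hj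
  have hlt : i < t.length := by omega
  have e1 : t[i]? = some t[i] := List.getElem?_eq_getElem _
  have hG := le_bar (g _ e1)
  rw [bar_bar] at hG
  have hb : t[i].2 = t[i].1.bar := le_antisymm' (l _ _ rfl e1) hG
  rw [fill_before ht h1 e1 hb, fill_after ht h2 e1 hb, List.take_succ_eq_append_getElem hlt,
    List.drop_eq_getElem_cons hlt]
  generalize s - t.length = m
  have key : List.replicate m t[i] ++ [t[i]] = [t[i]] ++ List.replicate m t[i] := by
    rw [← List.replicate_succ', List.replicate_succ]; rfl
  have := congrArg (fun X => t.take i ++ X ++ t.drop (i+1)) key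
  simp only [List.append_assoc, List.cons_append, List.nil_append] at this ⊢
  exact this

/-- Any `t ∈ ⋃_{k=0}^{s-1} B(kϖ₂)` has at most two filling
locations; if it has two, they are consecutive integers, and the resulting filled
tableau `F_{2,s}(t)` is the same for either choice. -/
theorem fillingLoc_atMostTwo (n s k : ℕ) (hn : 4 ≤ n) (hs : 1 ≤ s) (hk : k < s)
    (t : List Col) (ht : t ∈ BB n k) :
    (¬ ∃ i j l : ℕ, i ≠ j ∧ i ≠ l ∧ j ≠ l ∧
        isFillingLoc n s t i ∧ isFillingLoc n s t j ∧ isFillingLoc n s t l) ∧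
    (∀ i j, isFillingLoc n s t i → isFillingLoc n s t j → i ≠ j →
        i + 1 = j ∨ j + 1 = i) ∧
    (∀ i j T₁ T₂, isFillingLoc n s t i → isFillingLoc n s t j →
        fillAtRel n s t i T₁ → fillAtRel n s t j T₂ → i ≠ j → T₁ = T₂) := by
  have consec : ∀ i j, isFillingLoc n s t i → isFillingLoc n s t j → i ≠ j →
      i + 1 = j ∨ j + 1 = i := by
    intro i j hi hj hne
    rcases lt_or_gt_of_ne hne with h | h
    · exact Or.inl (loc_consec hk ht hi hj h)
    · exact Or.inr (loc_consec hk ht hj hi h)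
  refine ⟨?_, consec, ?_⟩
  · rintro ⟨i, j, l, h1, h2, h3, hi, hj, hl⟩
    have a := consec i j hi hj h1
    have b := consec i l hi hl h2
    have c := consec j l hj hl h3
    omega
  · intro i j T₁ T₂ hi hj h1 h2 hne
    rcases lt_or_gt_of_ne hne with h | h
    · exact fill_eq hk ht hi hj h1 h2 h
    · exact (fill_eq hk ht hj hi h2 h1 h).symm

end KR
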